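/- Let α ≥ 2 be a countable ordinal. If L ⊆ Σ^ω is Σ⁰_α-complete, then h(L) ∪ (Γ^ω − h(Σ^ω)) is a Σ⁰_α-complete subset of Γ^ω. -/

import Mathlib

universe u

/-- We equip `Option σ` (the alphabet `Γ = Σ ∪ {A}`, with `A = none`) with the
discrete topology. -/
instance instTopOption (σ : Type u) : TopologicalSpace (Option σ) := ⊥
instance instDiscreteOption (σ : Type u) : DiscreteTopology (Option σ) := ⟨rfl⟩

/-- Auxiliary function for the coding map `h`: reads position `i` inside the
concatenation of the blocks `A·0^(n+1)·x(n), A·0^(n+2)·x(n+1), ...`. -/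
def hAux {σ : Type u} (z : σ) (x : ℕ → σ) : ℕ → ℕ → Option σ
  | _, 0 => none
  | n, (i+1) =>
    if i + 1 ≤ n + 1 then some z
    else if i + 1 = n + 2 then some (x n)
    else hAux z x (n+1) (i + 1 - (n+3))
  termination_by n i => i
  decreasing_by omega

/-- The coding map `h : Σ^ω → Γ^ω`,
`h(x) = A·0·x(1)·A·0²·x(2)·A·0³·x(3)···A·0ⁿ·x(n)···` (ω-words indexed by `ℕ`). -/
def hmap {σ : Type u} (z : σ) (x : ℕ → σ) : ℕ → Option σ := fun i => hAux z x 0 i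

/-- Auxiliary function for the ω-word `α₀`. -/
def aAux {σ : Type u} (z : σ) : ℕ → ℕ → Option σ
  | _, 0 => none
  | n, (i+1) =>
    if i + 1 ≤ n + 1 then some z
    else aAux z (n+1) (i + 1 - (n+2))
  termination_by n i => i
  decreasing_by omega

/-- The ω-word `α₀ = A·0·A·0²·A·0³···A·0ⁿ···` over `Γ = Σ ∪ {A}`. -/
def alphaWord {σ : Type u} (z : σ) : ℕ → Option σ := fun i => aAux z 0 i

/-- The Borel hierarchy on a topological space `X`: `SigmaPi X α true` is the class
`Σ⁰_α` and `SigmaPi X α false` is the class `Π⁰_α`.  `Σ⁰_1` is the class of open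
sets, `Π⁰_1` is the class of closed sets, and for `α ≥ 2`, `Σ⁰_α` (resp. `Π⁰_α`)
is the class of countable unions (resp. intersections) of sets in
`⋃_{γ < α} Π⁰_γ` (resp. `⋃_{γ < α} Σ⁰_γ`). -/
def SigmaPi (X : Type u) [TopologicalSpace X] (α : Ordinal.{0}) (b : Bool) : Set (Set X) :=
  {s | (α = 1 ∧ ((b = true ∧ IsOpen s) ∨ (b = false ∧ IsClosed s)))
    ∨ (α ≠ 1 ∧ ∃ f : ℕ → Set X,
        (∀ n : ℕ, ∃ γ : Ordinal.{0}, ∃ _ : γ < α, f n ∈ SigmaPi X γ !b) ∧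
        s = if b then ⋃ n, f n else ⋂ n, f n)}
  termination_by α
  decreasing_by assumption

/-- The class `Σ⁰_α` of the Borel hierarchy on `X`. -/
abbrev Sigma0 (X : Type u) [TopologicalSpace X] (α : Ordinal.{0}) : Set (Set X) :=
  SigmaPi X α true

/-- The class `Π⁰_α` of the Borel hierarchy on `X`. -/
abbrev Pi0 (X : Type u) [TopologicalSpace X] (α : Ordinal.{0}) : Set (Set X) :=
  SigmaPi X α false

/-- `F ⊆ Σ^ω` is `Σ⁰_α`-complete (for `b = true`), resp. `Π⁰_α`-complete (for
`b = false`), iff for every nonempty finite alphabet `Y` and every `E ⊆ Y^ω`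
(with `Y^ω` carrying the Cantor topology, i.e. the product of the discrete
topology): `E ∈ Σ⁰_α` (resp. `Π⁰_α`) iff `E = f⁻¹(F)` for some continuous
`f : Y^ω → Σ^ω`. -/
def IsCompleteFor (b : Bool) (α : Ordinal.{0}) {σ : Type} [TopologicalSpace σ]
    (F : Set (ℕ → σ)) : Prop :=
  ∀ (Y : Type), Fintype Y → Nonempty Y → ∀ E : Set (ℕ → Y),
    letI : TopologicalSpace Y := ⊥
    (E ∈ SigmaPi (ℕ → Y) α b ↔
      ∃ f : (ℕ → Y) → (ℕ → σ), Continuous f ∧ E = f ⁻¹' F)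

/-- The infinite concatenation of the finite words `u 0, u 1, u 2, ...` equals the
ω-word `x`: every finite partial concatenation is a prefix of `x`, and the total
length is infinite. -/
def JoinsTo {α : Type u} (u : ℕ → List α) (x : ℕ → α) : Prop :=
  (∀ N : ℕ, ∃ n : ℕ, N ≤ (((List.range n).map u).flatten).length) ∧
  (∀ (n i : ℕ) (h : i < (((List.range n).map u).flatten).length),
      (((List.range n).map u).flatten)[i]'h = x i)

/-- A 2-tape Büchi automaton with input alphabet `σ` and output alphabet `γ`:
a finite set of states `Q`, a finite set `trans ⊆ Q × σ^⋆ × γ^⋆ × Q` of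
transitions, an initial state `init` and a set `acc` of accepting states. -/
structure TwoTapeBuchi (σ γ : Type u) where
  Q : Type u
  finQ : Finite Q
  trans : Set (Q × List σ × List γ × Q)
  finTrans : trans.Finite
  init : Q
  acc : Set Q

/-- The pair `(x, y)` of ω-words is accepted by the 2-tape Büchi automaton `T`
iff it is the pair of input and output words of some successful computation. -/
def TwoTapeBuchi.Accepts {σ γ : Type u} (T : TwoTapeBuchi σ γ)
    (x : ℕ → σ) (y : ℕ → γ) : Prop :=
  ∃ (q : ℕ → T.Q) (u : ℕ → List σ) (v : ℕ → List γ),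
    q 0 = T.init ∧
    (∀ n : ℕ, (q n, u n, v n, q (n+1)) ∈ T.trans) ∧
    (∃ qf ∈ T.acc, ∀ n : ℕ, ∃ m : ℕ, n ≤ m ∧ q m = qf) ∧
    JoinsTo u x ∧ JoinsTo v y

/-- `R ⊆ Σ^ω × Γ^ω` is an infinitary rational relation iff it is the relation
accepted by some 2-tape Büchi automaton. -/
def IsRatRel {σ γ : Type u} (R : Set ((ℕ → σ) × (ℕ → γ))) : Prop :=
  ∃ T : TwoTapeBuchi σ γ, ∀ p : (ℕ → σ) × (ℕ → γ), p ∈ R ↔ T.Accepts p.1 p.2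

/-- A real-time Büchi 1-counter automaton: transitions are in
`Q × σ × Bool × Q × ℤ` with the counter move in `{-1, 0, 1}`, and a zero test
(`false` means the counter is zero) which forbids decrementing a zero counter. -/
structure OneCounterBuchi (σ : Type u) where
  Q : Type u
  finQ : Finite Q
  trans : Set (Q × σ × Bool × Q × ℤ)
  transMoves : ∀ t ∈ trans, t.2.2.2.2 = -1 ∨ t.2.2.2.2 = 0 ∨ t.2.2.2.2 = 1
  transZero : ∀ t ∈ trans, t.2.2.1 = false → t.2.2.2.2 = 0 ∨ t.2.2.2.2 = 1
  init : Q
  acc : Set Q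

/-- One computation step of a 1-counter automaton on letter `a`, from
configuration `p` to configuration `p'`. -/
def OneCounterBuchi.Step {σ : Type u} (M : OneCounterBuchi σ) (a : σ)
    (p p' : M.Q × ℕ) : Prop :=
  ∃ j : ℤ, (p.1, a, (p.2 ≠ 0 : Bool), p'.1, j) ∈ M.trans ∧ (p'.2 : ℤ) = (p.2 : ℤ) + j

/-- The ω-word `x` is accepted by the real-time Büchi 1-counter automaton `M`:
there is a run on `x` starting in `(q₀, 0)` in which some accepting state occurs
infinitely often. -/
def OneCounterBuchi.Accepts {σ : Type u} (M : OneCounterBuchi σ) (x : ℕ → σ) : Prop :=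
  ∃ r : ℕ → M.Q × ℕ,
    r 0 = (M.init, 0) ∧
    (∀ i : ℕ, M.Step (x i) (r i) (r (i+1))) ∧
    ∃ qf ∈ M.acc, ∀ n : ℕ, ∃ m : ℕ, n ≤ m ∧ (r m).1 = qf

/-- The identification of a pair of ω-words with an ω-word over the product
alphabet. -/
def pairToWord {a b : Type u} (p : (ℕ → a) × (ℕ → b)) : ℕ → a × b :=
  fun n => (p.1 n, p.2 n)

/-- Start of block `n` in `h(x)`. -/
def blockStart : ℕ → ℕ
  | 0 => 0
  | n + 1 => blockStart n + (n + 3)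

theorem hAux_shift {σ : Type} (z : σ) (x : ℕ → σ) (n j : ℕ) :
    hAux z x n (n + 3 + j) = hAux z x (n + 1) j := by
  have e : n + 3 + j = (n + 2 + j) + 1 := by omega
  rw [e, hAux, if_neg (by omega), if_neg (by omega)]
  congr 1
  omega

theorem hAux_block {σ : Type} (z : σ) (x : ℕ → σ) (n : ℕ) :
    ∀ j, hAux z x 0 (blockStart n + j) = hAux z x n j := by
  induction n with
  | zero => intro j; simp [blockStart]
  | succ n ih =>
    intro j
    rw [blockStart, add_assoc, ih, hAux_shift]

theorem hAux_last {σ : Type} (z : σ) (x : ℕ → σ) (n : ℕ) :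
    hAux z x n (n + 2) = some (x n) := by
  rw [hAux, if_neg (by omega), if_pos (by omega)]

/-- Decoding map. -/
def decode {σ : Type} (z : σ) (y : ℕ → Option σ) : ℕ → σ :=
  fun n => (y (blockStart n + (n + 2))).getD z

theorem decode_hmap {σ : Type} (z : σ) (x : ℕ → σ) : decode z (hmap z x) = x := by
  funext n
  simp only [decode, hmap, hAux_block, hAux_last, Option.getD_some]

theorem continuous_hAux {σ : Type} [TopologicalSpace σ] [DiscreteTopology σ] (z : σ) (i : ℕ) :
    ∀ n, Continuous (fun x : ℕ → σ => hAux z x n i) := by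
  induction i using Nat.strong_induction_on with
  | _ i ih =>
    intro n
    cases i with
    | zero => simp only [hAux]; exact continuous_const
    | succ i =>
      simp only [hAux]
      split_ifs with h1 h2
      · exact continuous_const
      · exact continuous_of_discreteTopology.comp (continuous_apply n)
      · exact ih _ (by omega) _

theorem continuous_hmap {σ : Type} [TopologicalSpace σ] [DiscreteTopology σ] (z : σ) :
    Continuous (hmap z) :=
  continuous_pi fun i => continuous_hAux z i 0

theorem continuous_decode {σ : Type} [TopologicalSpace σ] [DiscreteTopology σ] (z : σ) :
    Continuous (decode z) :=
  continuous_pi fun n =>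
    (continuous_of_discreteTopology (f := fun o : Option σ => o.getD z)).comp (continuous_apply _)

theorem isClosed_range_hmap {σ : Type} [TopologicalSpace σ] [DiscreteTopology σ] (z : σ) :
    IsClosed (Set.range (hmap z)) := by
  have : Set.range (hmap z) = {y | hmap z (decode z y) = y} := by
    ext y
    constructor
    · rintro ⟨x, rfl⟩
      simp only [Set.mem_setOf_eq, decode_hmap]
    · intro h
      exact ⟨_, h⟩
  rw [this]
  exact isClosed_eq ((continuous_hmap z).comp (continuous_decode z)) continuous_id

theorem mem_sigma_iff {X : Type} [TopologicalSpace X] (α : Ordinal.{0}) (hα : 2 ≤ α) (s : Set X) :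
    s ∈ SigmaPi X α true ↔ ∃ f : ℕ → Set X,
      (∀ n, ∃ γ : Ordinal.{0}, γ < α ∧ f n ∈ SigmaPi X γ false) ∧ s = ⋃ n, f n := by
  have h1 : α ≠ 1 := by
    rintro rfl
    exact absurd hα (not_le.2 (by exact_mod_cast one_lt_two))
  rw [SigmaPi]
  simp [h1]

theorem sigma_union {X : Type} [TopologicalSpace X] (α : Ordinal.{0}) (hα : 2 ≤ α) (s t : Set X)
    (hs : s ∈ SigmaPi X α true) (ht : t ∈ SigmaPi X α true) : s ∪ t ∈ SigmaPi X α true := by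
  rw [mem_sigma_iff α hα] at *
  obtain ⟨f, hf, rfl⟩ := hs
  obtain ⟨g, hg, rfl⟩ := ht
  refine ⟨fun n => Sum.elim f g (Equiv.natSumNatEquivNat.symm n), fun n => ?_, ?_⟩
  · dsimp only
    rcases Equiv.natSumNatEquivNat.symm n with k | k
    · exact hf k
    · exact hg k
  · rw [Equiv.natSumNatEquivNat.symm.surjective.iUnion_comp (fun k => Sum.elim f g k)]
    ext x
    simp

theorem sigma_of_open {X : Type} [TopologicalSpace X] [TopologicalSpace.MetrizableSpace X]
    (α : Ordinal.{0}) (hα : 2 ≤ α) (s : Set X) (hs : IsOpen s) : s ∈ SigmaPi X α true := by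
  letI := TopologicalSpace.metrizableSpaceMetric X
  rw [mem_sigma_iff α hα]
  obtain ⟨F, hF, -, hU, -⟩ := hs.exists_iUnion_isClosed
  refine ⟨F, fun n => ⟨1, lt_of_lt_of_le (by exact_mod_cast one_lt_two) hα, ?_⟩, hU.symm⟩
  rw [SigmaPi]
  simp [hF n]


/-- For a countable ordinal `α ≥ 2`, if `L ⊆ Σ^ω` is
`Σ⁰_α`-complete then `h(L) ∪ (Γ^ω − h(Σ^ω))` is a `Σ⁰_α`-complete subset of
`Γ^ω`. -/
theorem hmap_image_union_compl_sigmaComplete (σ : Type) [Fintype σ] [Nonempty σ]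
    [TopologicalSpace σ] [DiscreteTopology σ] (z : σ)
    (α : Ordinal.{0}) (hα : 2 ≤ α) (hcount : α.card ≤ Cardinal.aleph0)
    (L : Set (ℕ → σ)) (hL : IsCompleteFor true α L) :
    IsCompleteFor true α (hmap z '' L ∪ (Set.range (hmap z))ᶜ) := by
  intro Y _ _ E
  letI : TopologicalSpace Y := ⊥
  haveI : DiscreteTopology Y := ⟨rfl⟩
  constructor
  · intro hE
    obtain ⟨f, hf, rfl⟩ := (hL Y inferInstance inferInstance E).1 hE
    refine ⟨hmap z ∘ f, (continuous_hmap z).comp hf, ?_⟩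
    ext y
    simp only [Set.mem_preimage, Function.comp, Set.mem_union, Set.mem_compl_iff,
      Set.mem_range_self, not_true_eq_false, or_false]
    constructor
    · intro h
      exact ⟨_, h, rfl⟩
    · rintro ⟨x, hx, he⟩
      have := congrArg (decode z) he
      rw [decode_hmap, decode_hmap] at this
      rwa [← this]
  · rintro ⟨f, hf, rfl⟩
    have e : f ⁻¹' (hmap z '' L ∪ (Set.range (hmap z))ᶜ)
        = (decode z ∘ f) ⁻¹' L ∪ (f ⁻¹' (Set.range (hmap z)))ᶜ := by
      ext y
      simp only [Set.mem_preimage, Function.comp, Set.mem_union, Set.mem_compl_iff]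
      by_cases h : f y ∈ Set.range (hmap z)
      · simp only [h, not_true_eq_false, or_false]
        obtain ⟨x, hx⟩ := h
        rw [← hx, decode_hmap]
        constructor
        · rintro ⟨x', hx', he⟩
          have := congrArg (decode z) he
          rw [decode_hmap, decode_hmap] at this
          rwa [← this]
        · intro h
          exact ⟨_, h, rfl⟩
      · simp only [h, not_false_eq_true, or_true]
    rw [e]
    apply sigma_union α hα
    · exact (hL Y inferInstance inferInstance _).2 ⟨_, (continuous_decode z).comp hf, rfl⟩
    · exact sigma_of_open α hα _ ((isClosed_range_hmap z).preimage hf).isOpen_compl
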